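/- Gradedness of the dyadic output grid: let G be a symmetric, monotonic grid on [a,b] that is locally quasi-uniform with constant C_g, let α satisfy 1 ≤ α and α·C_g ≤ 2, and let P₀ be a graded dyadic partition of [a,b] whose associated dyadic grid is symmetric and monotonic. If P is an α-output for (G,P₀), then P is graded. -/

import Mathlib

/-- The standard dyadic subinterval of `[a,b]` of level `p.1` and index `p.2`,
namely `[a + (b-a)·k·2^{-j}, a + (b-a)·(k+1)·2^{-j}]` for `p = (j,k)`. -/
def dInt (a b : ℝ) (p : ℕ × ℕ) : Set ℝ :=
  Set.Icc (a + (b - a) * p.2 / 2 ^ p.1) (a + (b - a) * (p.2 + 1) / 2 ^ p.1)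

/-- The length `(b-a)·2^{-j}` of a standard dyadic subinterval of level `p.1`. -/
noncomputable def dLen (a b : ℝ) (p : ℕ × ℕ) : ℝ := (b - a) / 2 ^ p.1

/-- The parent `(j-1, k/2)` of the dyadic interval indexed by `p = (j,k)`. -/
def dParent (p : ℕ × ℕ) : ℕ × ℕ := (p.1 - 1, p.2 / 2)

/-- A dyadic partition of `[a,b]`: a finite collection of standard dyadic
subintervals (encoded by their level/index pairs) with pairwise disjoint
interiors, whose union is `[a,b]`. -/
structure DyadicPartition (a b : ℝ) where
  ps : Finset (ℕ × ℕ)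
  valid : ∀ p ∈ ps, p.2 < 2 ^ p.1
  cover : (⋃ p ∈ ps, dInt a b p) = Set.Icc a b
  disj : ∀ p ∈ ps, ∀ q ∈ ps, p ≠ q →
    interior (dInt a b p) ∩ interior (dInt a b q) = ∅

/-- The dyadic grid associated with a dyadic partition: the set of endpoints of
its intervals. -/
def dGridSet {a b : ℝ} (P : DyadicPartition a b) : Set ℝ :=
  ⋃ p ∈ P.ps, ({a + (b - a) * p.2 / 2 ^ p.1, a + (b - a) * (p.2 + 1) / 2 ^ p.1} : Set ℝ)

/-- A grid on `[a,b]`: a finite strictly increasing sequence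
`a = x 0 < x 1 < ⋯ < x M = b`. -/
structure Grid (a b : ℝ) where
  M : ℕ
  M_pos : 0 < M
  x : ℕ → ℝ
  mono : StrictMonoOn x (Set.Iic M)
  left : x 0 = a
  right : x M = b

/-- The `i`-th interval `[x i, x (i+1)]` of the partition induced by a grid. -/
def Grid.interval {a b : ℝ} (G : Grid a b) (i : ℕ) : Set ℝ :=
  Set.Icc (G.x i) (G.x (i + 1))

/-- `m(I,G)`: the minimum length of a grid interval of `G` intersecting `I`. -/
noncomputable def Grid.gmin {a b : ℝ} (G : Grid a b) (I : Set ℝ) : ℝ :=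
  sInf {d : ℝ | ∃ i < G.M, (G.interval i ∩ I).Nonempty ∧ d = G.x (i + 1) - G.x i}

/-- `P` is an α-output of the algorithm `DyadicGrid(G, P₀, α)`:
(a) every interval of `P` is contained in some interval of `P₀`;
(b) every interval `D` of `P` satisfies `|D| ≤ α·m(D,G)`;
(c) every interval `D` of `P` not in `P₀` has a parent `D̂` with
    `|D̂| > α·m(D̂,G)`. -/
def IsAlphaOutput {a b : ℝ} (G : Grid a b) (P₀ P : DyadicPartition a b)
    (α : ℝ) : Prop :=
  (∀ p ∈ P.ps, ∃ q ∈ P₀.ps, dInt a b p ⊆ dInt a b q) ∧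
  (∀ p ∈ P.ps, dLen a b p ≤ α * G.gmin (dInt a b p)) ∧
  (∀ p ∈ P.ps, p ∉ P₀.ps →
    1 ≤ p.1 ∧ dLen a b (dParent p) > α * G.gmin (dInt a b (dParent p)))

/-- A grid is symmetric if `x i + x (M-i) = a + b` for all `0 ≤ i ≤ M`. -/
def Grid.Symmetric {a b : ℝ} (G : Grid a b) : Prop :=
  ∀ i ≤ G.M, G.x i + G.x (G.M - i) = a + b

/-- A grid is monotonic if for any two neighboring intervals contained in the
left half `[a, (a+b)/2]`, the left one is at most as long as the right one. -/
def Grid.Monotonic {a b : ℝ} (G : Grid a b) : Prop :=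
  ∀ i : ℕ, i + 1 < G.M →
    G.interval i ∪ G.interval (i + 1) ⊆ Set.Icc a ((a + b) / 2) →
    G.x (i + 1) - G.x i ≤ G.x (i + 2) - G.x (i + 1)

/-- A grid is locally quasi-uniform with constant `C` if any two intersecting
intervals of its induced partition have length ratio between `C⁻¹` and `C`. -/
def Grid.QuasiUniform {a b : ℝ} (G : Grid a b) (C : ℝ) : Prop :=
  ∀ i < G.M, ∀ j < G.M, (G.interval i ∩ G.interval j).Nonempty →
    C⁻¹ ≤ (G.x (i + 1) - G.x i) / (G.x (j + 1) - G.x j) ∧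
    (G.x (i + 1) - G.x i) / (G.x (j + 1) - G.x j) ≤ C

/-- The dyadic grid associated with `P` is symmetric (around the midpoint of
`[a,b]`). -/
def DyadicPartition.SymmetricGrid {a b : ℝ} (P : DyadicPartition a b) : Prop :=
  ∀ x ∈ dGridSet P, a + b - x ∈ dGridSet P

/-- The partition `P` is monotonic: for any two of its intervals contained in
the left half `[a, (a+b)/2]`, with the second the right neighbor of the first,
the left one is at most as long as the right one. -/
def DyadicPartition.Monotonic {a b : ℝ} (P : DyadicPartition a b) : Prop :=
  ∀ p ∈ P.ps, ∀ q ∈ P.ps,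
    dInt a b p ∪ dInt a b q ⊆ Set.Icc a ((a + b) / 2) →
    a + (b - a) * (p.2 + 1) / 2 ^ p.1 = a + (b - a) * q.2 / 2 ^ q.1 →
    dLen a b p ≤ dLen a b q

/-- A dyadic partition is graded if any two of its intervals sharing an
endpoint have lengths whose ratio lies in `[1/2, 2]`. -/
def DyadicPartition.Graded {a b : ℝ} (P : DyadicPartition a b) : Prop :=
  ∀ p ∈ P.ps, ∀ q ∈ P.ps,
    (({a + (b - a) * p.2 / 2 ^ p.1, a + (b - a) * (p.2 + 1) / 2 ^ p.1} : Set ℝ) ∩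
      ({a + (b - a) * q.2 / 2 ^ q.1, a + (b - a) * (q.2 + 1) / 2 ^ q.1} : Set ℝ)).Nonempty →
    1 / 2 ≤ dLen a b p / dLen a b q ∧ dLen a b p / dLen a b q ≤ 2

namespace Grid

variable {a b : ℝ} (G : Grid a b)

theorem x_le_x {i j : ℕ} (hij : i ≤ j) (hj : j ≤ G.M) : G.x i ≤ G.x j :=
  G.mono.monotoneOn (Set.mem_Iic.2 (hij.trans hj)) (Set.mem_Iic.2 hj) hij

theorem length_pos {i : ℕ} (hi : i < G.M) : 0 < G.x (i + 1) - G.x i :=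
  sub_pos.2 (G.mono (Set.mem_Iic.2 hi.le) (Set.mem_Iic.2 hi) i.lt_succ_self)

theorem exists_le_lt {z : ℝ} (h₁ : a ≤ z) (h₂ : z < b) :
    ∃ i < G.M, G.x i ≤ z ∧ z < G.x (i + 1) := by
  classical
  have hex : ∃ n, z < G.x n := ⟨G.M, by rwa [G.right]⟩
  obtain ⟨i, hi⟩ : ∃ i, Nat.find hex = i + 1 := by
    refine Nat.exists_eq_succ_of_ne_zero fun h => ?_
    have := Nat.find_spec hex
    rw [h, G.left] at this
    exact absurd this h₁.not_gt
  refine ⟨i, ?_, not_lt.1 (Nat.find_min hex (by omega)), hi ▸ Nat.find_spec hex⟩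
  have : Nat.find hex ≤ G.M := Nat.find_min' hex (by rwa [G.right])
  omega

theorem exists_lt_le {z : ℝ} (h₁ : a < z) (h₂ : z ≤ b) :
    ∃ i < G.M, G.x i < z ∧ z ≤ G.x (i + 1) := by
  classical
  have hex : ∃ n, z ≤ G.x n := ⟨G.M, by rwa [G.right]⟩
  obtain ⟨i, hi⟩ : ∃ i, Nat.find hex = i + 1 := by
    refine Nat.exists_eq_succ_of_ne_zero fun h => ?_
    have := Nat.find_spec hex
    rw [h, G.left] at this
    exact absurd this h₁.not_ge
  refine ⟨i, ?_, not_le.1 (Nat.find_min hex (by omega)), hi ▸ Nat.find_spec hex⟩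
  have : Nat.find hex ≤ G.M := Nat.find_min' hex (by rwa [G.right])
  omega

theorem exists_mem_interval (hab : a < b) {z : ℝ} (h₁ : a ≤ z) (h₂ : z ≤ b) :
    ∃ i < G.M, z ∈ G.interval i := by
  rcases h₁.eq_or_lt with rfl | h
  · obtain ⟨i, hi, h, h'⟩ := G.exists_le_lt le_rfl hab
    exact ⟨i, hi, h, h'.le⟩
  · obtain ⟨i, hi, h, h'⟩ := G.exists_lt_le h h₂
    exact ⟨i, hi, h.le, h'⟩

theorem gmin_le {I : Set ℝ} {i : ℕ} (hi : i < G.M) (h : (G.interval i ∩ I).Nonempty) :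
    G.gmin I ≤ G.x (i + 1) - G.x i := by
  refine csInf_le ⟨0, ?_⟩ ⟨i, hi, h, rfl⟩
  rintro _ ⟨j, hj, -, rfl⟩
  exact (G.length_pos hj).le

theorem exists_length_lt_of_gmin_lt (hab : a < b) {I : Set ℝ} {z c : ℝ} (hz : z ∈ I)
    (h₁ : a ≤ z) (h₂ : z ≤ b) (h : G.gmin I < c) :
    ∃ i < G.M, (G.interval i ∩ I).Nonempty ∧ G.x (i + 1) - G.x i < c := by
  obtain ⟨i, hi, hzi⟩ := G.exists_mem_interval hab h₁ h₂
  have hne : {d : ℝ | ∃ i < G.M, (G.interval i ∩ I).Nonempty ∧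
      d = G.x (i + 1) - G.x i}.Nonempty := ⟨_, i, hi, ⟨z, hzi, hz⟩, rfl⟩
  obtain ⟨_, ⟨j, hj, hne, rfl⟩, hlt⟩ := exists_lt_of_csInf_lt hne h
  exact ⟨j, hj, hne, hlt⟩

variable {G}

theorem QuasiUniform.length_le {C : ℝ} (hG : G.QuasiUniform C) {i j : ℕ} (hi : i < G.M)
    (hj : j < G.M) (h : (G.interval i ∩ G.interval j).Nonempty) :
    G.x (i + 1) - G.x i ≤ C * (G.x (j + 1) - G.x j) :=
  (div_le_iff₀ (G.length_pos hj)).1 (hG i hi j hj h).2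

theorem QuasiUniform.one_le {C : ℝ} (hG : G.QuasiUniform C) : 1 ≤ C := by
  have hp := G.length_pos G.M_pos
  have := (hG 0 G.M_pos 0 G.M_pos
    ⟨G.x 0, ⟨⟨le_rfl, (sub_pos.1 hp).le⟩, ⟨le_rfl, (sub_pos.1 hp).le⟩⟩⟩).2
  rwa [div_self hp.ne'] at this

/-- In a locally quasi-uniform grid, if every grid interval containing `z` has length at least
`C * h`, then every grid interval meeting `[z - h, z + h]` has length at least `h`. -/
theorem QuasiUniform.le_length {C : ℝ} (hG : G.QuasiUniform C) {z h : ℝ}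
    (hza : a ≤ z) (hzb : z ≤ b)
    (hz : ∀ i < G.M, z ∈ G.interval i → C * h ≤ G.x (i + 1) - G.x i)
    {j : ℕ} (hj : j < G.M) {y : ℝ} (hy : y ∈ G.interval j) (hyz : |y - z| ≤ h) :
    h ≤ G.x (j + 1) - G.x j := by
  have hC := hG.one_le
  have hadj : ∀ i < G.M, ∀ k < G.M, (G.interval i ∩ G.interval k).Nonempty →
      z ∈ G.interval i → h ≤ G.x (k + 1) - G.x k := fun i hi k hk hik hzi => by
    have h₁ := hz i hi hzi
    have h₂ := hG.length_le hi hk hik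
    exact le_of_mul_le_mul_left (h₁.trans h₂) (by linarith)
  have hjp := G.length_pos hj
  obtain ⟨hy₁, hy₂⟩ := hy
  obtain ⟨hyz₁, hyz₂⟩ := abs_le.1 hyz
  by_cases hzj : z ∈ G.interval j
  · exact hadj j hj j hj ⟨z, hzj, hzj⟩ hzj
  rcases lt_or_ge z (G.x j) with hlt | hge
  · have hjb : G.x j ≤ b := (G.x_le_x hj.le le_rfl).trans_eq G.right
    obtain ⟨i, hi, hi₁, hi₂⟩ := G.exists_le_lt hza (hlt.trans_le hjb)
    have hip := G.length_pos hi
    have hij : i < j := by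
      by_contra! hc
      exact absurd (G.x_le_x hc hi.le) (by linarith)
    have hi1 : i + 1 < G.M := by omega
    have hip1 := G.length_pos hi1
    have key := hadj i hi (i + 1) hi1
      ⟨G.x (i + 1), ⟨by linarith, le_rfl⟩, ⟨le_rfl, by linarith⟩⟩ ⟨hi₁, hi₂.le⟩
    rcases (Nat.succ_le_of_lt hij).eq_or_lt with rfl | hlt'
    · exact key
    · have := G.x_le_x (show i + 1 + 1 ≤ j from hlt') hj.le
      linarith
  · have hgt : G.x (j + 1) < z := by
      by_contra! hc
      exact hzj ⟨hge, hc⟩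
    have haj : a ≤ G.x (j + 1) := G.left.symm.trans_le (G.x_le_x (Nat.zero_le _) hj)
    obtain ⟨i, hi, hi₁, hi₂⟩ := G.exists_lt_le (haj.trans_lt hgt) hzb
    have hip := G.length_pos hi
    have hij : j < i := by
      by_contra! hc
      exact absurd (G.x_le_x (Nat.add_le_add_right hc 1) hj) (by linarith)
    obtain ⟨k, rfl⟩ : ∃ k, i = k + 1 := ⟨i - 1, by omega⟩
    have hk : k < G.M := by omega
    have hkp := G.length_pos hk
    have key := hadj (k + 1) hi k hk
      ⟨G.x (k + 1), ⟨le_rfl, by linarith⟩, ⟨by linarith, le_rfl⟩⟩ ⟨hi₁.le, hi₂⟩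
    rcases (Nat.le_of_lt_succ hij).eq_or_lt with rfl | hlt'
    · exact key
    · have := G.x_le_x (show j + 1 ≤ k from hlt') hk.le
      linarith

end Grid

section DyadicIntervals

variable {a b : ℝ}

theorem dLen_pos (hab : a < b) (p : ℕ × ℕ) : 0 < dLen a b p :=
  div_pos (sub_pos.2 hab) (by positivity)

theorem dInt_eq (p : ℕ × ℕ) :
    dInt a b p = Set.Icc (a + dLen a b p * p.2) (a + dLen a b p * p.2 + dLen a b p) := by
  unfold dInt dLen
  congr 1 <;> ring

theorem endpoints_eq (p : ℕ × ℕ) :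
    ({a + (b - a) * p.2 / 2 ^ p.1, a + (b - a) * (p.2 + 1) / 2 ^ p.1} : Set ℝ) =
      {a + dLen a b p * p.2, a + dLen a b p * p.2 + dLen a b p} := by
  unfold dLen
  congr 1
  · ring
  · congr 1; ring

theorem dLen_dParent {p : ℕ × ℕ} (hp : 1 ≤ p.1) : dLen a b (dParent p) = 2 * dLen a b p := by
  obtain ⟨j, k⟩ := p
  obtain ⟨i, rfl⟩ : ∃ i, j = i + 1 := ⟨j - 1, by simp only at hp; omega⟩
  simp only [dLen, dParent, Nat.add_sub_cancel, pow_succ]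
  field_simp

theorem dInt_subset_dInt_dParent (hab : a < b) {p : ℕ × ℕ} (hp : 1 ≤ p.1) :
    dInt a b p ⊆ dInt a b (dParent p) := by
  have hpos := dLen_pos hab p
  rw [dInt_eq, dInt_eq, dLen_dParent hp]
  have h₁ : (2 * (p.2 / 2 : ℕ) : ℝ) ≤ p.2 := by exact_mod_cast (by omega : 2 * (p.2 / 2) ≤ p.2)
  have h₂ : (p.2 : ℝ) ≤ 2 * (p.2 / 2 : ℕ) + 1 := by
    exact_mod_cast (by omega : p.2 ≤ 2 * (p.2 / 2) + 1)
  refine Set.Icc_subset_Icc ?_ ?_ <;> simp only [dParent] <;> nlinarith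

theorem level_lt_of_dLen_lt (hab : a < b) {p q : ℕ × ℕ} (h : dLen a b q < dLen a b p) :
    p.1 < q.1 := by
  by_contra! hc
  refine absurd h (not_lt.2 ?_)
  have := sub_pos.2 hab
  unfold dLen
  gcongr
  norm_num

theorem two_mul_dLen_le (hab : a < b) {p q : ℕ × ℕ} (h : p.1 < q.1) :
    2 * dLen a b q ≤ dLen a b p := by
  have hpos := sub_pos.2 hab
  have h2 : (2 : ℝ) ^ (p.1 + 1) ≤ 2 ^ q.1 := pow_le_pow_right₀ (by norm_num) h
  unfold dLen
  rw [mul_div_assoc', div_le_div_iff₀ (by positivity) (by positivity)]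
  rw [pow_succ] at h2
  nlinarith

theorem dLen_le_of_subset (hab : a < b) {p q : ℕ × ℕ} (h : dInt a b p ⊆ dInt a b q) :
    dLen a b p ≤ dLen a b q := by
  have hp := dLen_pos hab p
  rw [dInt_eq, dInt_eq, Set.Icc_subset_Icc_iff (by linarith)] at h
  linarith [h.1, h.2]

theorem abs_sub_le_dLen {p : ℕ × ℕ} {y z : ℝ} (hy : y ∈ dInt a b p) (hz : z ∈ dInt a b p) :
    |y - z| ≤ dLen a b p := by
  rw [dInt_eq] at hy hz
  rw [abs_le]
  constructor <;> linarith [hy.1, hy.2, hz.1, hz.2]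

theorem interior_inter_dInt_nonempty (hab : a < b) {p : ℕ × ℕ} {U : Set ℝ} (hU : IsOpen U)
    {z : ℝ} (hzU : z ∈ U) (hz : z ∈ dInt a b p) : (U ∩ interior (dInt a b p)).Nonempty := by
  have hp := dLen_pos hab p
  have hcl : z ∈ closure (interior (dInt a b p)) := by
    rw [dInt_eq] at hz ⊢
    rwa [interior_Icc, closure_Ioo (by linarith)]
  exact mem_closure_iff.1 hcl U hU hzU

theorem DyadicPartition.dInt_subset (P : DyadicPartition a b) {p : ℕ × ℕ} (hp : p ∈ P.ps) :
    dInt a b p ⊆ Set.Icc a b :=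
  P.cover ▸ Set.subset_biUnion_of_mem (u := fun p => dInt a b p) hp

theorem DyadicPartition.eq_of_inter (P : DyadicPartition a b) {p q : ℕ × ℕ} (hp : p ∈ P.ps)
    (hq : q ∈ P.ps) (h : (interior (dInt a b p) ∩ interior (dInt a b q)).Nonempty) : p = q := by
  by_contra hne
  exact h.ne_empty (P.disj p hp q hq hne)

theorem mem_dInt_of_mem_endpoints (hab : a < b) {p : ℕ × ℕ} {z : ℝ}
    (hz : z ∈ ({a + (b - a) * p.2 / 2 ^ p.1, a + (b - a) * (p.2 + 1) / 2 ^ p.1} : Set ℝ)) :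
    z ∈ dInt a b p := by
  have hp := dLen_pos hab p
  rw [endpoints_eq] at hz
  rw [dInt_eq]
  rcases hz with rfl | rfl <;> constructor <;> linarith

theorem mem_endpoints_of_not_mem_interior {p : ℕ × ℕ} {z : ℝ} (hz : z ∈ dInt a b p)
    (hzi : z ∉ interior (dInt a b p)) :
    z ∈ ({a + (b - a) * p.2 / 2 ^ p.1, a + (b - a) * (p.2 + 1) / 2 ^ p.1} : Set ℝ) := by
  rw [dInt, interior_Icc] at hzi
  by_contra hne
  simp only [Set.mem_insert_iff, Set.mem_singleton_iff, not_or] at hne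
  exact hzi ⟨lt_of_le_of_ne hz.1 (Ne.symm hne.1), lt_of_le_of_ne hz.2 hne.2⟩

end DyadicIntervals

namespace IsAlphaOutput

variable {a b α C : ℝ} {G : Grid a b} {P₀ P : DyadicPartition a b} {p q : ℕ × ℕ} {z : ℝ}

/-- An interval of an output that was created by a subdivision is at least half as long as any
interval of the output that meets it. -/
theorem dLen_le_of_not_mem (hab : a < b) (hP : IsAlphaOutput G P₀ P α) (hG : G.QuasiUniform C)
    (hα₁ : 1 ≤ α) (hα₂ : α * C ≤ 2) (hp : p ∈ P.ps) (hq : q ∈ P.ps) (hq₀ : q ∉ P₀.ps)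
    (hzp : z ∈ dInt a b p) (hzq : z ∈ dInt a b q) : dLen a b p ≤ 2 * dLen a b q := by
  by_contra! hlt
  obtain ⟨-, hb, hc⟩ := hP
  obtain ⟨hq1, hq2⟩ := hc q hq hq₀
  have hαpos : 0 < α := by linarith
  have hza := P.dInt_subset hp hzp
  have hzq' := dInt_subset_dInt_dParent hab hq1 hzq
  have hhpos := dLen_pos hab (dParent q)
  have hlen : 2 * dLen a b (dParent q) ≤ dLen a b p := by
    refine two_mul_dLen_le hab (level_lt_of_dLen_lt hab ?_)
    rwa [dLen_dParent hq1]
  have hlt' : G.gmin (dInt a b (dParent q)) < dLen a b (dParent q) / α := by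
    rw [lt_div_iff₀ hαpos]
    linarith
  obtain ⟨j, hj, ⟨y, hyj, hyq⟩, hjlt⟩ :=
    G.exists_length_lt_of_gmin_lt hab hzq' hza.1 hza.2 hlt'
  have hC := hG.one_le
  have key := hG.le_length hza.1 hza.2 (fun i hi hzi => by
    have h₁ := (hb p hp).trans
      (mul_le_mul_of_nonneg_left (G.gmin_le hi ⟨z, hzi, hzp⟩) hαpos.le)
    have h₂ : α * (C * dLen a b (dParent q)) ≤ 2 * dLen a b (dParent q) := by
      rw [← mul_assoc]
      exact mul_le_mul_of_nonneg_right hα₂ hhpos.le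
    exact le_of_mul_le_mul_left (h₂.trans (hlen.trans h₁)) hαpos) hj hyj (abs_sub_le_dLen hyq hzq')
  have := div_le_self hhpos.le hα₁
  linarith

/-- An interval of an output inherited from a graded initial partition is at least half as long
as any interval of the output with which it shares an endpoint. -/
theorem dLen_le_of_mem (hab : a < b) (hP : IsAlphaOutput G P₀ P α) (hP₀ : P₀.Graded)
    (hp : p ∈ P.ps) (hq₀ : q ∈ P₀.ps) (hzp : z ∈ dInt a b p)
    (hz : z ∈ ({a + (b - a) * q.2 / 2 ^ q.1, a + (b - a) * (q.2 + 1) / 2 ^ q.1} : Set ℝ)) :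
    dLen a b p ≤ 2 * dLen a b q := by
  obtain ⟨r, hr, hpr⟩ := hP.1 p hp
  have hqpos := dLen_pos hab q
  have hle := dLen_le_of_subset hab hpr
  by_cases hzr : z ∈ interior (dInt a b r)
  · have hrq := P₀.eq_of_inter hr hq₀ (interior_inter_dInt_nonempty hab isOpen_interior hzr
      (mem_dInt_of_mem_endpoints hab hz))
    rw [hrq] at hle
    linarith
  · have := (hP₀ r hr q hq₀ ⟨z, mem_endpoints_of_not_mem_interior (hpr hzp) hzr, hz⟩).2
    rw [div_le_iff₀ hqpos] at this
    linarith

end IsAlphaOutput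

/-- Gradedness of the dyadic output grid: if `G` is a symmetric, monotonic grid
that is locally quasi-uniform with constant `C_g`, `1 ≤ α` and `α·C_g ≤ 2`, and
`P₀` is a graded dyadic partition whose associated grid is symmetric and
monotonic, then any α-output `P` for `(G,P₀)` is graded. -/
theorem dyadic_output_graded {a b : ℝ} (hab : a < b)
    (G : Grid a b) (hGsym : G.Symmetric) (hGmono : G.Monotonic)
    (Cg : ℝ) (hG : G.QuasiUniform Cg)
    (α : ℝ) (hα1 : 1 ≤ α) (hα2 : α * Cg ≤ 2)
    (P₀ P : DyadicPartition a b)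
    (hP₀graded : P₀.Graded) (hP₀sym : P₀.SymmetricGrid) (hP₀mono : P₀.Monotonic)
    (hP : IsAlphaOutput G P₀ P α) :
    P.Graded := by
  have key : ∀ p ∈ P.ps, ∀ q ∈ P.ps, ∀ z,
      z ∈ ({a + (b - a) * p.2 / 2 ^ p.1, a + (b - a) * (p.2 + 1) / 2 ^ p.1} : Set ℝ) →
      z ∈ ({a + (b - a) * q.2 / 2 ^ q.1, a + (b - a) * (q.2 + 1) / 2 ^ q.1} : Set ℝ) →
      dLen a b p ≤ 2 * dLen a b q := by
    intro p hp q hq z hzp hzq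
    have hzp' := mem_dInt_of_mem_endpoints hab hzp
    by_cases hq₀ : q ∈ P₀.ps
    · exact hP.dLen_le_of_mem hab hP₀graded hp hq₀ hzp' hzq
    · exact hP.dLen_le_of_not_mem hab hG hα1 hα2 hp hq hq₀ hzp'
        (mem_dInt_of_mem_endpoints hab hzq)
  rintro p hp q hq ⟨z, hzp, hzq⟩
  have hqpos := dLen_pos hab q
  rw [le_div_iff₀ hqpos, div_le_iff₀ hqpos]
  exact ⟨by linarith [key q hq p hp z hzq hzp], key p hp q hq z hzp hzq⟩
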